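/- arXiv:2405.13987 — 3 statements merged into one kernel-verified Lean document; each statement's English description precedes it below -/
import Mathlib

section
/- In the 2-block stochastic block model with p ≥ log³n / n, with probability 1 − n^{−Ω(1)} the following holds simultaneously for all vertices u ∈ V and all k ∈ {1, 2, ..., O(log n)}: |e_uᵀ R'^k s| ≤ (1/√n) · ( C·√(log n/(pn)) )^k, for some absolute constant C, where e_u is the u-th standard basis vector. -/
open MeasureTheory ProbabilityTheory Matrix

/-- Bernoulli measure on `Bool` with success probability `p`. -/
noncomputable def bern (p : ℝ) : Measure Bool :=
  ENNReal.ofReal (1 - p) • Measure.dirac false + ENNReal.ofReal p • Measure.dirac true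

/-- Edge randomness of the 2-block stochastic block model on `n` vertices:
independent Bernoulli variables, with probability `p` for pairs inside a class and `q`
across classes.  Class `S` consists of the first `n/2` vertices; only the upper triangle
is used to build the (symmetric) adjacency matrix. -/
noncomputable def sbm (n : ℕ) (p q : ℝ) : Measure (Fin n → Fin n → Bool) :=
  Measure.pi fun i => Measure.pi fun j =>
    bern (if ((i : ℕ) < n / 2 ↔ (j : ℕ) < n / 2) then p else q)

/-- The (symmetric, hollow) adjacency matrix built from the edge indicators. -/
noncomputable def adjM {n : ℕ} (ω : Fin n → Fin n → Bool) : Matrix (Fin n) (Fin n) ℝ :=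
  Matrix.of fun i j =>
    if i = j then 0 else if (if i ≤ j then ω i j else ω j i) then 1 else 0

/-- Empirical average degree `d = 2|E|/n`. -/
noncomputable def avgDeg {n : ℕ} (ω : Fin n → Fin n → Bool) : ℝ :=
  (∑ i, ∑ j, adjM ω i j) / n

/-- Corrected graph convolution matrix `Ã = (1/d)A - (1/n)𝟙𝟙ᵀ`. -/
noncomputable def tildeA {n : ℕ} (ω : Fin n → Fin n → Bool) : Matrix (Fin n) (Fin n) ℝ :=
  (avgDeg ω)⁻¹ • adjM ω - (n : ℝ)⁻¹ • Matrix.of (fun _ _ => (1 : ℝ))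

/-- The unit signal vector `s`, with entries `1/√n` on `S` and `-1/√n` on `T`. -/
noncomputable def sig (n : ℕ) : Fin n → ℝ :=
  fun i => if (i : ℕ) < n / 2 then (Real.sqrt n)⁻¹ else -(Real.sqrt n)⁻¹

/-- Spectral norm (ℓ²→ℓ² operator norm) of a real square matrix. -/
noncomputable def specNorm {n : ℕ} (M : Matrix (Fin n) (Fin n) ℝ) : ℝ :=
  ‖Matrix.toEuclideanCLM (𝕜 := ℝ) M‖

/-- The error matrix `R' = Ã - η ssᵀ`, with `η = (p-q)n/(2d)`. -/
noncomputable def errM {n : ℕ} (p q : ℝ) (ω : Fin n → Fin n → Bool) :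
    Matrix (Fin n) (Fin n) ℝ :=
  tildeA ω - ((p - q) * n / (2 * avgDeg ω)) • Matrix.vecMulVec (sig n) (sig n)

/-- `Y` is a combination, with coefficients in `[-1, 1]`, of monomials of degree `L` in the
variables `g e`, such that weighting each monomial by `β` per distinct variable outside a small
set `F` gives a total of at most `B ^ L`. -/
def HasMonomialExpansion {E Ω : Type} [DecidableEq E] (g : E → Ω → ℝ) (β B : ℝ) (N L : ℕ)
    (Y : Ω → ℝ) : Prop :=
  ∃ (ι : Type) (_ : Fintype ι) (c : ι → ℝ) (M : ι → Multiset E),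
    (∀ i, |c i| ≤ 1) ∧ (∀ i, Multiset.card (M i) = L) ∧
    (∀ ω, Y ω = ∑ i, c i * ((M i).map fun e => g e ω).prod) ∧
    ∀ F : Finset E, F.card + L ≤ N → ∑ i, β ^ ((M i).toFinset \ F).card ≤ B ^ L

namespace HasMonomialExpansion

variable {E Ω : Type} [DecidableEq E] {g : E → Ω → ℝ} {β B : ℝ} {N L K : ℕ} {Y Z : Ω → ℝ}

lemma const {a : ℝ} (ha : |a| ≤ 1) : HasMonomialExpansion g β B N 0 fun _ => a :=
  ⟨Unit, inferInstance, fun _ => a, fun _ => 0, fun _ => ha, fun _ => rfl, by simp, by simp⟩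

lemma card_add_sdiff (s t F : Finset E) :
    ((s ∪ t) \ F).card = (s \ F).card + (t \ (F ∪ s)).card := by
  rw [← Finset.card_union_of_disjoint]
  · congr 1
    ext x
    simp only [Finset.mem_sdiff, Finset.mem_union]
    tauto
  · rw [Finset.disjoint_left]
    intro x
    simp only [Finset.mem_sdiff, Finset.mem_union]
    tauto

lemma mul (hβ : 0 ≤ β) (hB : 0 ≤ B) (hY : HasMonomialExpansion g β B N L Y)
    (hZ : HasMonomialExpansion g β B N K Z) :
    HasMonomialExpansion g β B N (L + K) fun ω => Y ω * Z ω := by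
  obtain ⟨ι, _, c, M, hc, hM, hYe, hYw⟩ := hY
  obtain ⟨κ, _, d, M', hd, hM', hZe, hZw⟩ := hZ
  refine ⟨ι × κ, inferInstance, fun x => c x.1 * d x.2, fun x => M x.1 + M' x.2, ?_, ?_, ?_, ?_⟩
  · intro x
    rw [abs_mul]
    exact mul_le_one₀ (hc _) (abs_nonneg _) (hd _)
  · simp [hM, hM']
  · intro ω
    show Y ω * Z ω = _
    rw [hYe, hZe, Fintype.sum_mul_sum, Fintype.sum_prod_type]
    simp only [Multiset.map_add, Multiset.prod_add]
    refine Finset.sum_congr rfl fun i _ => Finset.sum_congr rfl fun j _ => by ring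
  · intro F hF
    rw [Fintype.sum_prod_type, pow_add]
    calc ∑ i, ∑ j, β ^ ((M i + M' j).toFinset \ F).card
        = ∑ i, β ^ ((M i).toFinset \ F).card *
            ∑ j, β ^ ((M' j).toFinset \ (F ∪ (M i).toFinset)).card := by
          simp only [Finset.mul_sum, Multiset.toFinset_add, card_add_sdiff, pow_add]
      _ ≤ ∑ i, β ^ ((M i).toFinset \ F).card * B ^ K := by
          gcongr with i
          refine hZw _ ?_
          have h1 := Finset.card_union_le F (M i).toFinset
          have h2 := Multiset.toFinset_card_le (M i)
          have h3 := hM i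
          omega
      _ ≤ B ^ L * B ^ K := by
          rw [← Finset.sum_mul]
          gcongr
          exact hYw F (by omega)

lemma pow (hβ : 0 ≤ β) (hB : 0 ≤ B) (hY : HasMonomialExpansion g β B N L Y) (r : ℕ) :
    HasMonomialExpansion g β B N (r * L) fun ω => Y ω ^ r := by
  induction r with
  | zero => simpa using const (a := 1) (by simp)
  | succ r ih =>
    have := ih.mul hβ hB hY
    simpa only [pow_succ, add_mul, one_mul] using this

lemma sum_step {V : Type} [Fintype V] (hβ : 0 ≤ β) (hB : Fintype.card V * β + N ≤ B)
    {e : V → E} (he : Function.Injective e) {Y : V → Ω → ℝ}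
    (hY : ∀ x, HasMonomialExpansion g β B N L (Y x)) :
    HasMonomialExpansion g β B N (L + 1) fun ω => ∑ x, g (e x) ω * Y x ω := by
  have hB0 : 0 ≤ B := le_trans (by positivity) hB
  choose ι inst c M hc hM hYe hYw using hY
  refine ⟨Σ x, ι x, inferInstance, fun y => c y.1 y.2, fun y => e y.1 ::ₘ M y.1 y.2,
    fun y => hc _ _, fun y => by simp [hM], ?_, ?_⟩
  · intro ω
    rw [Fintype.sum_sigma]
    refine Finset.sum_congr rfl fun x _ => ?_
    rw [hYe, Finset.mul_sum]
    refine Finset.sum_congr rfl fun i _ => ?_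
    rw [Multiset.map_cons, Multiset.prod_cons]
    ring
  · intro F hF
    rw [Fintype.sum_sigma]
    have hstep : ∀ x, ∑ i, β ^ ((e x ::ₘ M x i).toFinset \ F).card ≤
        B ^ L * (β + if e x ∈ F then 1 else 0) := by
      intro x
      calc ∑ i, β ^ ((e x ::ₘ M x i).toFinset \ F).card
          = (∑ i, β ^ ((M x i).toFinset \ (F ∪ {e x})).card) *
              β ^ (({e x} : Finset E) \ F).card := by
            simp only [Multiset.toFinset_cons, Finset.insert_eq, card_add_sdiff, pow_add,
              Finset.sum_mul]
            exact Finset.sum_congr rfl fun i _ => mul_comm _ _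
        _ ≤ B ^ L * (β + if e x ∈ F then 1 else 0) := by
            gcongr
            · refine hYw x _ ?_
              have := Finset.card_union_le F {e x}
              rw [Finset.card_singleton] at this
              omega
            · by_cases hx : e x ∈ F
              · simp [hx, Finset.sdiff_eq_empty_iff_subset.2 (Finset.singleton_subset_iff.2 hx), hβ]
              · simp [hx, Finset.sdiff_eq_self_of_disjoint (Finset.disjoint_singleton_left.2 hx)]
    have hcount : (∑ x, if e x ∈ F then (1 : ℝ) else 0) ≤ N := by
      rw [Finset.sum_boole]
      have h1 : (Finset.univ.filter fun x => e x ∈ F).card ≤ F.card :=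
        Finset.card_le_card_of_injOn e (fun x hx => by simpa using hx) he.injOn
      exact_mod_cast h1.trans (by omega)
    calc _ ≤ ∑ x, B ^ L * (β + if e x ∈ F then 1 else 0) := Finset.sum_le_sum fun x _ => hstep x
      _ = B ^ L * (Fintype.card V * β + ∑ x, if e x ∈ F then (1 : ℝ) else 0) := by
          rw [← Finset.mul_sum, Finset.sum_add_distrib]
          simp
      _ ≤ B ^ (L + 1) := by
          rw [pow_succ]
          gcongr
          linarith

end HasMonomialExpansion

/-- Connection probability of the pair `(i, j)`. -/
noncomputable def edgeProb (n : ℕ) (p q : ℝ) (i j : Fin n) : ℝ :=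
  if ((i : ℕ) < n / 2 ↔ (j : ℕ) < n / 2) then p else q

/-- Centered edge indicator of the pair `e`, zero on the diagonal. -/
noncomputable def centeredEdge {n : ℕ} (P : Fin n → Fin n → ℝ) (e : Fin n × Fin n)
    (ω : Fin n → Fin n → Bool) : ℝ :=
  if e.1 = e.2 then 0 else (if ω e.1 e.2 then 1 else 0) - P e.1 e.2

/-- The centered adjacency matrix `R = A - E[A]`. -/
noncomputable def noise {n : ℕ} (P : Fin n → Fin n → ℝ) (ω : Fin n → Fin n → Bool) :
    Matrix (Fin n) (Fin n) ℝ :=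
  Matrix.of fun i j => centeredEdge P (min i j, max i j) ω

lemma min_max_injective {n : ℕ} (u : Fin n) :
    Function.Injective fun x : Fin n => (min u x, max u x) := by
  intro x y h
  simp only [Prod.mk.injEq] at h
  grind

lemma noise_pow_hasMonomialExpansion {n N : ℕ} {β B : ℝ} (P : Fin n → Fin n → ℝ)
    (hβ : 0 ≤ β) (hB : n * β + N ≤ B) {f : Fin n → ℝ} (hf : ∀ x, |f x| ≤ 1) (m : ℕ) (u : Fin n) :
    HasMonomialExpansion (centeredEdge P) β B N m fun ω => ((noise P ω ^ m).mulVec f) u := by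
  induction m generalizing u with
  | zero => simpa using HasMonomialExpansion.const (hf u)
  | succ m ih =>
    have h := HasMonomialExpansion.sum_step hβ (by simpa using hB) (min_max_injective u) ih
    convert h using 2 with ω
    rw [pow_succ', ← Matrix.mulVec_mulVec]
    rfl

lemma isProbabilityMeasure_bern {p : ℝ} (h0 : 0 ≤ p) (h1 : p ≤ 1) :
    IsProbabilityMeasure (bern p) := by
  constructor
  simp only [bern, Measure.coe_add, Measure.coe_smul, Pi.add_apply, Pi.smul_apply, measure_univ,
    smul_eq_mul, mul_one]
  rw [← ENNReal.ofReal_add (by linarith) h0]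
  simp

lemma integral_bern {p : ℝ} (h0 : 0 ≤ p) (h1 : p ≤ 1) (f : Bool → ℝ) :
    ∫ b, f b ∂(bern p) = (1 - p) * f false + p * f true := by
  rw [bern, integral_add_measure ((integrable_dirac (by simp)).smul_measure (by simp))
    ((integrable_dirac (by simp)).smul_measure (by simp))]
  rw [integral_smul_measure, integral_smul_measure, integral_dirac, integral_dirac,
    ENNReal.toReal_ofReal (by linarith), ENNReal.toReal_ofReal h0]
  simp

lemma abs_integral_centered_pow_le {p s μ : ℝ} (h0 : 0 ≤ s) (hs : s ≤ p) (h1 : p ≤ 1)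
    (hμ : 1 ≤ μ) (k : ℕ) :
    |∫ b, ((if b then 1 else 0) - s) ^ k ∂(bern s)| ≤ μ ^ k * (if k = 0 then 1 else p / μ ^ 2) := by
  rw [integral_bern h0 (hs.trans h1)]
  match k with
  | 0 => simp
  | 1 =>
    simp only [Bool.false_eq_true, if_false, if_true]
    ring_nf
    simp only [abs_zero]
    have : 0 ≤ p := h0.trans hs
    simp
    positivity
  | k + 2 =>
    simp only [Bool.false_eq_true, if_false, if_true]
    have hμk : 1 ≤ μ ^ k := one_le_pow₀ hμ
    have e1 : μ ^ (k + 2) * (if k + 2 = 0 then 1 else p / μ ^ 2) = μ ^ k * p := by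
      have : μ ≠ 0 := by positivity
      simp only [Nat.add_eq_zero_iff, OfNat.ofNat_ne_zero, and_false, if_false, pow_add]
      field_simp
    rw [e1]
    have h1s : 0 ≤ 1 - s := by linarith
    have ha : |(0 - s) ^ (k + 2)| ≤ s ^ 2 := by
      rw [abs_pow, zero_sub, abs_neg, abs_of_nonneg h0]
      exact pow_le_pow_of_le_one h0 (hs.trans h1) (by omega)
    have hb : |(1 - s) ^ (k + 2)| ≤ (1 - s) ^ 2 := by
      rw [abs_pow, abs_of_nonneg h1s]
      exact pow_le_pow_of_le_one h1s (by linarith) (by omega)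
    calc |(1 - s) * (0 - s) ^ (k + 2) + s * (1 - s) ^ (k + 2)|
        ≤ (1 - s) * |(0 - s) ^ (k + 2)| + s * |(1 - s) ^ (k + 2)| := by
          refine (abs_add_le _ _).trans ?_
          rw [abs_mul, abs_mul, abs_of_nonneg h0, abs_of_nonneg h1s]
      _ ≤ (1 - s) * s ^ 2 + s * (1 - s) ^ 2 := by gcongr
      _ ≤ 1 * p := by nlinarith
      _ ≤ μ ^ k * p := by
          have : 0 ≤ p := h0.trans hs
          gcongr

/-- Law of independent edge indicators with success probabilities `P i j`. -/
noncomputable def edgeLaw {n : ℕ} (P : Fin n → Fin n → ℝ) : Measure (Fin n → Fin n → Bool) :=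
  Measure.pi fun i => Measure.pi fun j => bern (P i j)

section EdgeLaw

variable {n : ℕ} {P : Fin n → Fin n → ℝ} {p : ℝ}

lemma isProbabilityMeasure_edgeLaw (h0 : ∀ i j, 0 ≤ P i j) (h1 : ∀ i j, P i j ≤ 1) :
    IsProbabilityMeasure (edgeLaw P) := by
  have : ∀ i j, IsProbabilityMeasure (bern (P i j)) :=
    fun i j => isProbabilityMeasure_bern (h0 i j) (h1 i j)
  unfold edgeLaw
  infer_instance

lemma abs_integral_centeredEdge_prod_le (h0 : ∀ i j, 0 ≤ P i j) (hP : ∀ i j, P i j ≤ p)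
    (h1 : p ≤ 1) {μ : ℝ} (hμ : 1 ≤ μ) (M : Multiset (Fin n × Fin n)) :
    |∫ ω, (M.map fun e => centeredEdge P e ω).prod ∂(edgeLaw P)| ≤
      μ ^ (Multiset.card M) * (p / μ ^ 2) ^ M.toFinset.card := by
  have : ∀ i j, IsProbabilityMeasure (bern (P i j)) :=
    fun i j => isProbabilityMeasure_bern (h0 i j) ((hP i j).trans h1)
  have hprod : ∀ ω, (M.map fun e => centeredEdge P e ω).prod =
      ∏ i, ∏ j, (if i = j then 0 else (if ω i j then 1 else 0) - P i j) ^ M.count (i, j) := by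
    intro ω
    rw [Finset.prod_multiset_map_count, ← Fintype.prod_prod_type'
      (f := fun i j => (if i = j then (0 : ℝ) else (if ω i j then 1 else 0) - P i j) ^
        M.count (i, j))]
    refine Finset.prod_subset (Finset.subset_univ _) fun e _ he => ?_
    rw [Multiset.mem_toFinset, ← Multiset.count_eq_zero] at he
    rw [he, pow_zero]
  simp only [hprod, edgeLaw]
  rw [integral_fintype_prod_eq_prod (fun i (x : Fin n → Bool) =>
    ∏ j, (if i = j then (0 : ℝ) else (if x j then 1 else 0) - P i j) ^ M.count (i, j))]
  have hinner : ∀ i, ∫ x : Fin n → Bool, ∏ j, (if i = j then (0 : ℝ) else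
      (if x j then 1 else 0) - P i j) ^ M.count (i, j) ∂(Measure.pi fun j => bern (P i j)) =
      ∏ j, ∫ b, (if i = j then (0 : ℝ) else
        (if b then 1 else 0) - P i j) ^ M.count (i, j) ∂(bern (P i j)) := fun i =>
    integral_fintype_prod_eq_prod (fun j (b : Bool) => (if i = j then (0 : ℝ) else
      (if b then 1 else 0) - P i j) ^ M.count (i, j))
  simp only [hinner, Finset.abs_prod]
  have hfac : ∀ i j, |∫ b, (if i = j then (0 : ℝ) else
        (if b then 1 else 0) - P i j) ^ M.count (i, j) ∂(bern (P i j))| ≤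
      μ ^ M.count (i, j) * (if M.count (i, j) = 0 then 1 else p / μ ^ 2) := by
    intro i j
    by_cases hij : i = j
    · by_cases hc : M.count (i, j) = 0
      · simp only [hc, pow_zero, if_true, mul_one, integral_const, probReal_univ]
        simp
      · have hp : 0 ≤ p := (h0 i j).trans (hP i j)
        simp only [if_pos hij, zero_pow hc, integral_zero, abs_zero]
        positivity
    · simpa only [if_neg hij] using
        abs_integral_centered_pow_le (h0 i j) (hP i j) h1 hμ (M.count (i, j))
  calc _ ≤ ∏ i, ∏ j, (μ ^ M.count (i, j) * (if M.count (i, j) = 0 then 1 else p / μ ^ 2)) :=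
        Finset.prod_le_prod (fun i _ => Finset.prod_nonneg fun j _ => abs_nonneg _)
          fun i _ => Finset.prod_le_prod (fun j _ => abs_nonneg _) fun j _ => hfac i j
    _ = _ := by
        rw [← Fintype.prod_prod_type' (f := fun i j => μ ^ M.count (i, j) *
          (if M.count (i, j) = 0 then 1 else p / μ ^ 2)), Finset.prod_mul_distrib,
          Finset.prod_pow_eq_pow_sum]
        congr 1
        · congr 1
          exact Multiset.sum_count_eq_card fun _ _ => Finset.mem_univ _
        · rw [← Finset.prod_subset (Finset.subset_univ M.toFinset)]
          · rw [← Finset.prod_const]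
            refine Finset.prod_congr rfl fun e he => if_neg ?_
            rwa [Multiset.mem_toFinset, ← Multiset.count_ne_zero] at he
          · intro e _ he
            rw [Multiset.mem_toFinset, ← Multiset.count_eq_zero] at he
            simp [he]

lemma integral_le_of_hasMonomialExpansion (h0 : ∀ i j, 0 ≤ P i j) (hP : ∀ i j, P i j ≤ p)
    (h1 : p ≤ 1) {μ : ℝ} (hμ : 1 ≤ μ) {B : ℝ} {N : ℕ} {Y : (Fin n → Fin n → Bool) → ℝ}
    (hY : HasMonomialExpansion (centeredEdge P) (p / μ ^ 2) B N N Y) :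
    ∫ ω, Y ω ∂(edgeLaw P) ≤ (μ * B) ^ N := by
  have := isProbabilityMeasure_edgeLaw h0 fun i j => (hP i j).trans h1
  obtain ⟨ι, _, c, M, hc, hM, hYe, hYw⟩ := hY
  simp only [hYe]
  rw [integral_finsetSum _ fun i _ => Integrable.of_finite]
  simp only [integral_const_mul]
  calc _ ≤ ∑ i, μ ^ N * (p / μ ^ 2) ^ (M i).toFinset.card := by
        refine Finset.sum_le_sum fun i _ => (le_abs_self _).trans ?_
        rw [abs_mul, ← hM i]
        exact (mul_le_of_le_one_left (abs_nonneg _) (hc i)).trans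
          (abs_integral_centeredEdge_prod_le h0 hP h1 hμ _)
    _ ≤ μ ^ N * B ^ N := by
        rw [← Finset.mul_sum]
        gcongr
        simpa using hYw ∅ (by simp)
    _ = _ := (mul_pow _ _ _).symm

lemma measureReal_noise_pow_le (h0 : ∀ i j, 0 ≤ P i j) (hP : ∀ i j, P i j ≤ p) (h1 : p ≤ 1)
    {f : Fin n → ℝ} (hf : ∀ x, |f x| ≤ 1) (u : Fin n) {m r : ℕ} (hm : 1 ≤ m) (hr : 1 ≤ r)
    (hL : ((2 * r * m : ℕ) : ℝ) ≤ n * p) {t : ℝ} (ht : 0 < t) :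
    (edgeLaw P).real {ω | t ^ m ≤ |((noise P ω ^ m).mulVec f) u|} ≤
      (2 * √(n * p * (2 * r * m : ℕ)) / t) ^ (2 * r * m) := by
  have := isProbabilityMeasure_edgeLaw h0 fun i j => (hP i j).trans h1
  set L : ℕ := 2 * r * m
  have hLpos : (0 : ℝ) < L := by positivity
  have hnp : 0 < n * p := hLpos.trans_le hL
  have hn : (0 : ℝ) < n := by
    rcases Nat.eq_zero_or_pos n with h | h
    · simp [h] at hnp
    · exact_mod_cast h
  set μ : ℝ := √(n * p / L)
  have hμsq : μ ^ 2 = n * p / L := Real.sq_sqrt (by positivity)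
  have hμ : 1 ≤ μ := Real.one_le_sqrt.2 ((one_le_div hLpos).2 hL)
  have hp : 0 < p := pos_of_mul_pos_right hnp hn.le
  have hβ : p / μ ^ 2 = L / n := by
    rw [hμsq]
    field_simp
  have hmom : ∫ ω, ((noise P ω ^ m).mulVec f) u ^ (2 * r) ∂(edgeLaw P) ≤ (μ * (2 * L)) ^ L := by
    refine integral_le_of_hasMonomialExpansion h0 hP h1 hμ ?_
    refine (noise_pow_hasMonomialExpansion (N := L) P (by positivity) ?_ hf m u).pow
      (by positivity) (by positivity) (2 * r)
    rw [hβ]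
    field_simp
    linarith
  have hset : {ω | t ^ m ≤ |((noise P ω ^ m).mulVec f) u|} ⊆
      {ω | t ^ L ≤ ((noise P ω ^ m).mulVec f) u ^ (2 * r)} := by
    intro ω hω
    have h2 : (t ^ m) ^ (2 * r) ≤ |((noise P ω ^ m).mulVec f) u| ^ (2 * r) :=
      pow_le_pow_left₀ (by positivity) hω _
    rwa [← pow_mul, mul_comm m, Even.pow_abs ⟨r, by ring⟩] at h2
  have hmarkov := mul_meas_ge_le_integral_of_nonneg (μ := edgeLaw P)
    (f := fun ω => ((noise P ω ^ m).mulVec f) u ^ (2 * r))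
    (Filter.Eventually.of_forall fun ω => Even.pow_nonneg ⟨r, by ring⟩ _) Integrable.of_finite
    (t ^ L)
  have hroot : μ * (2 * L) = 2 * √(n * p * L) := by
    have : n * p * L = n * p / L * L ^ 2 := by field_simp
    rw [this, Real.sqrt_mul (by positivity), Real.sqrt_sq hLpos.le]
    ring
  refine (measureReal_mono hset).trans ?_
  rw [div_pow, le_div_iff₀ (by positivity), mul_comm, ← hroot]
  exact hmarkov.trans hmom

end EdgeLaw

section LogTail

variable {n : ℕ} {P : Fin n → Fin n → ℝ} {p Ck : ℝ}

lemma measureReal_noise_pow_log_le (h0 : ∀ i j, 0 ≤ P i j) (hP : ∀ i j, P i j ≤ p) (h1 : p ≤ 1)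
    {f : Fin n → ℝ} (hf : ∀ x, |f x| ≤ 1) (hCk : 0 < Ck) (hn : 1 < n)
    (hlog : 2 * (1 + Ck) * Real.log n ≤ p * n) (u : Fin n) {m : ℕ} (hm : 1 ≤ m)
    (hmle : (m : ℝ) ≤ Ck * Real.log n) :
    (edgeLaw P).real {ω | (2 * √(2 * (1 + Ck)) * Real.exp 2 * √(p * n * Real.log n)) ^ m ≤
      |((noise P ω ^ m).mulVec f) u|} ≤ ((n : ℝ) ^ 4)⁻¹ := by
  have hlogpos : 0 < Real.log n := Real.log_pos (by exact_mod_cast hn)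
  have hpn : 0 < p * n := lt_of_lt_of_le (by positivity) hlog
  have hm0 : (0 : ℝ) < m := by exact_mod_cast hm
  set r := ⌈Real.log n / m⌉₊
  have hr1 : 1 ≤ r := Nat.ceil_pos.2 (by positivity)
  have hlow : Real.log n ≤ r * m := (div_le_iff₀ hm0).1 (Nat.le_ceil _)
  have hup : (r : ℝ) * m ≤ Real.log n + m := by
    have := (Nat.ceil_lt_add_one (div_nonneg hlogpos.le hm0.le)).le
    calc (r : ℝ) * m ≤ (Real.log n / m + 1) * m := by gcongr
      _ = _ := by field_simp
  have hL : ((2 * r * m : ℕ) : ℝ) ≤ 2 * (1 + Ck) * Real.log n := by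
    push_cast
    linarith
  have hroot : 0 < √(2 * (1 + Ck)) := Real.sqrt_pos.2 (by positivity)
  have hT : 0 < √(p * n * Real.log n) := Real.sqrt_pos.2 (by positivity)
  refine (measureReal_noise_pow_le h0 hP h1 hf u hm hr1 (by linarith) (by positivity)).trans ?_
  calc _ ≤ (Real.exp (-2)) ^ (2 * r * m) := by
        gcongr
        rw [div_le_iff₀ (by positivity), Real.exp_neg]
        have : √(n * p * (2 * r * m : ℕ)) ≤ √(2 * (1 + Ck)) * √(p * n * Real.log n) := by
          rw [← Real.sqrt_mul (by positivity)]
          refine Real.sqrt_le_sqrt ?_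
          nlinarith
        rw [mul_comm p] at this ⊢
        field_simp
        exact this
    _ = Real.exp (-4 * (r * m)) := by
        rw [← Real.exp_nat_mul]
        push_cast
        ring_nf
    _ ≤ Real.exp (-(4 * Real.log n)) := Real.exp_le_exp.2 (by linarith)
    _ = _ := by
        rw [Real.exp_neg, mul_comm, Real.exp_mul, Real.exp_log (by positivity)]
        norm_cast

lemma measureReal_exists_noise_pow_le (h0 : ∀ i j, 0 ≤ P i j) (hP : ∀ i j, P i j ≤ p)
    (h1 : p ≤ 1) {f : Fin n → ℝ} (hf : ∀ x, |f x| ≤ 1) (hCk : 0 < Ck) (hn : 1 < n)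
    (hlog : 2 * (1 + Ck) * Real.log n ≤ p * n) :
    (edgeLaw P).real {ω | ∃ (u : Fin n) (m : ℕ), 1 ≤ m ∧ (m : ℝ) ≤ Ck * Real.log n ∧
      (2 * √(2 * (1 + Ck)) * Real.exp 2 * √(p * n * Real.log n)) ^ m ≤
        |((noise P ω ^ m).mulVec f) u|} ≤ ((n : ℝ) ^ 2)⁻¹ := by
  have := isProbabilityMeasure_edgeLaw h0 fun i j => (hP i j).trans h1
  have hlogpos : 0 < Real.log n := Real.log_pos (by exact_mod_cast hn)
  have hn0 : (0 : ℝ) < n := by positivity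
  set I : Finset ℕ := (Finset.Icc 1 n).filter fun m => (m : ℝ) ≤ Ck * Real.log n
  have hsub : {ω : Fin n → Fin n → Bool | ∃ (u : Fin n) (m : ℕ), 1 ≤ m ∧
      (m : ℝ) ≤ Ck * Real.log n ∧
      (2 * √(2 * (1 + Ck)) * Real.exp 2 * √(p * n * Real.log n)) ^ m ≤
        |((noise P ω ^ m).mulVec f) u|} ⊆
      ⋃ x ∈ (Finset.univ : Finset (Fin n)) ×ˢ I,
        {ω | (2 * √(2 * (1 + Ck)) * Real.exp 2 * √(p * n * Real.log n)) ^ x.2 ≤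
          |((noise P ω ^ x.2).mulVec f) x.1|} := by
    rintro ω ⟨u, m, hm1, hm2, hω⟩
    have hmn : m ≤ n := by
      have : (m : ℝ) ≤ n := by nlinarith
      exact_mod_cast this
    exact Set.mem_biUnion (x := (u, m)) (by simp [I, hm1, hm2, hmn]) hω
  have hcard : (I.card : ℝ) ≤ n := by
    have h := Finset.card_filter_le (Finset.Icc 1 n) fun m : ℕ => (m : ℝ) ≤ Ck * Real.log n
    rw [Nat.card_Icc, Nat.add_sub_cancel] at h
    exact_mod_cast h
  calc _ ≤ _ := measureReal_mono hsub (measure_ne_top _ _)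
    _ ≤ _ := measureReal_biUnion_finset_le _ _
    _ ≤ ∑ x ∈ (Finset.univ : Finset (Fin n)) ×ˢ I, ((n : ℝ) ^ 4)⁻¹ := by
        refine Finset.sum_le_sum fun x hx => ?_
        simp only [I, Finset.mem_product, Finset.mem_filter, Finset.mem_Icc] at hx
        exact measureReal_noise_pow_log_le h0 hP h1 hf hCk hn hlog x.1 hx.2.1.1 hx.2.2
    _ = n * I.card * ((n : ℝ) ^ 4)⁻¹ := by simp
    _ ≤ n * n * ((n : ℝ) ^ 4)⁻¹ := by gcongr
    _ = _ := by field_simp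

end LogTail

lemma abs_pow_mulVec_le_of_perturbation {n K : ℕ} (X : Matrix (Fin n) (Fin n) ℝ)
    {a b D ε S : ℝ} {s : Fin n → ℝ} (_hD : 0 ≤ D) (hε : 0 ≤ ε) (ha : |a| * n ≤ ε) (hb : |b| ≤ ε)
    (hone : ∀ m ≤ K, ∀ u, |((X ^ m).mulVec fun _ => 1) u| ≤ D ^ m)
    (hs : ∀ m ≤ K, ∀ u, |((X ^ m).mulVec s) u| ≤ S * D ^ m) (k : ℕ) :
    ∀ m, m + k ≤ K → ∀ u, |((X ^ m).mulVec
      (((X + a • Matrix.of (fun _ _ => (1 : ℝ)) + b • (1 : Matrix (Fin n) (Fin n) ℝ)) ^ k).mulVec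
        s)) u| ≤ S * D ^ m * (D + 2 * ε) ^ k := by
  induction k with
  | zero => simpa using hs
  | succ k ih =>
    intro m hmk u
    set v := ((X + a • Matrix.of (fun _ _ => (1 : ℝ)) +
      b • (1 : Matrix (Fin n) (Fin n) ℝ)) ^ k).mulVec s with hv
    have hstep : ((X + a • Matrix.of (fun _ _ => (1 : ℝ)) +
        b • (1 : Matrix (Fin n) (Fin n) ℝ)) ^ (k + 1)).mulVec s =
        X.mulVec v + (a * ∑ i, v i) • (fun _ => (1 : ℝ)) + b • v := by
      rw [pow_succ', ← Matrix.mulVec_mulVec, ← hv, Matrix.add_mulVec, Matrix.add_mulVec,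
        Matrix.smul_mulVec, Matrix.smul_mulVec, Matrix.one_mulVec]
      congr 2
      ext i
      simp [Matrix.mulVec, dotProduct]
    have hsum : |∑ i, v i| ≤ n * (S * (D + 2 * ε) ^ k) := by
      refine (Finset.abs_sum_le_sum_abs _ _).trans ?_
      calc ∑ i, |v i| ≤ ∑ _i : Fin n, S * (D + 2 * ε) ^ k :=
            Finset.sum_le_sum fun i _ => by simpa using ih 0 (by omega) i
        _ = _ := by simp
    have hSG : 0 ≤ S * (D + 2 * ε) ^ k := by
      simpa using (abs_nonneg _).trans (ih 0 (by omega) u)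
    rw [hstep, Matrix.mulVec_add, Matrix.mulVec_add, Matrix.mulVec_smul, Matrix.mulVec_smul,
      Matrix.mulVec_mulVec, ← pow_succ]
    simp only [Pi.add_apply, Pi.smul_apply, smul_eq_mul]
    have t1 := ih (m + 1) (by omega) u
    have t2 : |a * (∑ i, v i) * ((X ^ m).mulVec fun _ => 1) u| ≤
        ε * (S * (D + 2 * ε) ^ k) * D ^ m := by
      rw [abs_mul, abs_mul]
      refine mul_le_mul ?_ (hone m (by omega) u) (abs_nonneg _) (by positivity)
      calc |a| * |∑ i, v i| ≤ |a| * (n * (S * (D + 2 * ε) ^ k)) := by gcongr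
        _ = |a| * n * (S * (D + 2 * ε) ^ k) := by ring
        _ ≤ _ := by gcongr
    have t3 : |b * ((X ^ m).mulVec v) u| ≤ ε * (S * D ^ m * (D + 2 * ε) ^ k) := by
      rw [abs_mul]
      exact mul_le_mul hb (ih m (by omega) u) (abs_nonneg _) hε
    calc _ ≤ S * D ^ (m + 1) * (D + 2 * ε) ^ k + ε * (S * (D + 2 * ε) ^ k) * D ^ m +
          ε * (S * D ^ m * (D + 2 * ε) ^ k) :=
          (abs_add_three _ _ _).trans (add_le_add (add_le_add t1 t2) t3)
      _ = _ := by ring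

section Sbm

variable {n : ℕ} {p q : ℝ}

lemma sum_sig (hn : Even n) : ∑ i, sig n i = 0 := by
  obtain ⟨h, rfl⟩ := hn
  have hh : (h + h) / 2 = h := by omega
  simp [sig, Fin.sum_univ_add, hh]

lemma sig_mul_sig (i j : Fin n) :
    n * (sig n i * sig n j) = if ((i : ℕ) < n / 2 ↔ (j : ℕ) < n / 2) then 1 else -1 := by
  have hn : (0 : ℝ) < n := by exact_mod_cast i.pos
  have hsq : (√n)⁻¹ * (√n)⁻¹ = (n : ℝ)⁻¹ := by rw [← mul_inv, Real.mul_self_sqrt hn.le]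
  have hone : (n : ℝ) * ((√n)⁻¹ * (√n)⁻¹) = 1 := by rw [hsq, mul_inv_cancel₀ hn.ne']
  simp only [sig]
  split_ifs <;> first | tauto | linarith

lemma adjM_apply (ω : Fin n → Fin n → Bool) (i j : Fin n) :
    adjM ω i j = noise (edgeProb n p q) ω i j + (p + q) / 2 +
      (p - q) / 2 * (n * (sig n i * sig n j)) - p * (1 : Matrix (Fin n) (Fin n) ℝ) i j := by
  rw [sig_mul_sig]
  simp only [adjM, noise, centeredEdge, edgeProb, Matrix.of_apply, Matrix.one_apply]
  rcases lt_trichotomy i j with h | h | h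
  · simp only [h.ne, h.le, if_true, if_false, min_eq_left, max_eq_right]
    split_ifs <;> ring
  · subst h
    simp
    ring
  · simp only [h.ne, h.ne', h.le, not_le.2 h, if_false, min_eq_right, max_eq_left,
      iff_comm (a := (j : ℕ) < n / 2)]
    split_ifs <;> ring

lemma errM_eq (ω : Fin n → Fin n → Bool) :
    errM p q ω = (avgDeg ω)⁻¹ • noise (edgeProb n p q) ω +
      ((p + q) / 2 * (avgDeg ω)⁻¹ - (n : ℝ)⁻¹) • Matrix.of (fun _ _ => (1 : ℝ)) +
      (-(p * (avgDeg ω)⁻¹)) • (1 : Matrix (Fin n) (Fin n) ℝ) := by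
  ext i j
  simp only [errM, tildeA, Matrix.sub_apply, Matrix.add_apply, Matrix.smul_apply, smul_eq_mul,
    Matrix.of_apply, Matrix.vecMulVec_apply, adjM_apply (p := p) (q := q)]
  ring

lemma avgDeg_mul (hn : Even n) (hn0 : n ≠ 0) (ω : Fin n → Fin n → Bool) :
    avgDeg ω * n = ∑ i, ((noise (edgeProb n p q) ω).mulVec fun _ => 1) i +
      (p + q) / 2 * n * n - p * n := by
  rw [avgDeg, div_mul_cancel₀ _ (by exact_mod_cast hn0)]
  simp only [adjM_apply (p := p) (q := q), Finset.sum_sub_distrib, Finset.sum_add_distrib,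
    ← Finset.mul_sum, sum_sig hn, Matrix.mulVec, dotProduct]
  simp [Matrix.one_apply]
  ring

end Sbm

/-- Deterministic part: bounds on the powers of the noise matrix applied to the constant vector
and to the signal give bounds on the powers of the error matrix applied to the signal. -/
lemma abs_errM_pow_mulVec_le {n : ℕ} {p q C₀ Ck : ℝ} (hn : Even n) (hq : 0 ≤ q) (hp : 0 < p)
    (hp1 : p ≤ 1) (hC₀ : 0 < C₀) (hlog : 4 * (1 + C₀) ≤ Real.log n)
    (hpn : Real.log n ^ 3 ≤ p * n) (hCkL : 1 ≤ Ck * Real.log n) (ω : Fin n → Fin n → Bool)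
    (hone : ∀ (u : Fin n) (m : ℕ), 1 ≤ m → (m : ℝ) ≤ Ck * Real.log n →
      |((noise (edgeProb n p q) ω ^ m).mulVec fun _ => 1) u| ≤ (C₀ * √(p * n * Real.log n)) ^ m)
    (hsig : ∀ (u : Fin n) (m : ℕ), 1 ≤ m → (m : ℝ) ≤ Ck * Real.log n →
      |((noise (edgeProb n p q) ω ^ m).mulVec (√n • sig n)) u| ≤
        (C₀ * √(p * n * Real.log n)) ^ m)
    (u : Fin n) (k : ℕ) (hk : (k : ℝ) ≤ Ck * Real.log n) :
    |((errM p q ω ^ k).mulVec (sig n)) u| ≤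
      (√n)⁻¹ * ((12 * C₀ + 8) * √(Real.log n / (p * n))) ^ k := by
  have hn0 : (0 : ℝ) < n := by exact_mod_cast u.pos
  set R := noise (edgeProb n p q) ω with hR
  set L := Real.log n
  set d := avgDeg ω with hd
  set T := √(p * n * L) with hT
  set ε := √(L / (p * n)) with hε
  have hL : 1 ≤ L := by linarith
  have hpn0 : 0 < p * n := by positivity
  have hε0 : 0 ≤ ε := Real.sqrt_nonneg _
  have hTε : T = p * n * ε := by
    rw [hT, hε, ← Real.sqrt_sq hpn0.le, ← Real.sqrt_mul (by positivity),
      Real.sqrt_sq hpn0.le]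
    congr 1
    field_simp
  have hT1 : 1 ≤ T := by
    refine Real.one_le_sqrt.2 ?_
    have : 1 ≤ p * n := (one_le_pow₀ hL).trans hpn
    nlinarith
  have hTle : T * L ≤ p * n := by
    rw [hT, ← Real.sqrt_sq (by positivity : 0 ≤ L), ← Real.sqrt_mul (by positivity),
      Real.sqrt_sq (by positivity)]
    refine Real.sqrt_le_iff.2 ⟨hpn0.le, ?_⟩
    nlinarith
  have hTsmall : (1 + C₀) * T ≤ p * n / 4 := by nlinarith
  have hdiff : |d - (p + q) / 2 * n| ≤ (1 + C₀) * T := by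
    have hdn := avgDeg_mul (p := p) (q := q) hn (by exact_mod_cast hn0.ne') ω
    rw [← hR, ← hd] at hdn
    have hsum : |∑ i, (R.mulVec fun _ => 1) i| ≤ n * (C₀ * T) := by
      refine (Finset.abs_sum_le_sum_abs _ _).trans ?_
      calc _ ≤ ∑ _i : Fin n, C₀ * T := Finset.sum_le_sum fun i _ => by
            simpa using hone i 1 le_rfl (by simpa using hCkL)
        _ = _ := by simp
    rw [abs_le] at hsum ⊢
    constructor <;> nlinarith
  have hdlow : p * n / 4 ≤ d := by
    have := (abs_le.1 hdiff).1
    have : 0 ≤ q * n := by positivity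
    linarith
  have hd0 : 0 < d := by linarith
  have hTd : T * d⁻¹ ≤ 4 * ε := by
    rw [← div_eq_mul_inv, div_le_iff₀ hd0, hTε]
    nlinarith
  have hpow : ∀ (m : ℕ) (f : Fin n → ℝ),
      ((d⁻¹ • R) ^ m).mulVec f = (d⁻¹) ^ m • (R ^ m).mulVec f := fun m f => by
    rw [smul_pow, Matrix.smul_mulVec]
  have hscale : ∀ (m : ℕ) (y : ℝ), |y| ≤ (C₀ * T) ^ m → |(d⁻¹) ^ m * y| ≤ (4 * C₀ * ε) ^ m := by
    intro m y hy
    rw [abs_mul, abs_of_nonneg (by positivity)]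
    calc (d⁻¹) ^ m * |y| ≤ (d⁻¹) ^ m * (C₀ * T) ^ m := by gcongr
      _ = (C₀ * (T * d⁻¹)) ^ m := by rw [← mul_pow]; ring
      _ ≤ (C₀ * (4 * ε)) ^ m := by gcongr
      _ = _ := by ring
  have hmk : ∀ m ≤ k, (m : ℝ) ≤ Ck * L := fun m hm => le_trans (by exact_mod_cast hm) hk
  have key := abs_pow_mulVec_le_of_perturbation (K := k) (d⁻¹ • R)
    (a := (p + q) / 2 * d⁻¹ - (n : ℝ)⁻¹) (b := -(p * d⁻¹)) (D := 4 * C₀ * ε)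
    (ε := 4 * (1 + C₀) * ε) (S := (√n)⁻¹) (s := sig n) (by positivity) (by positivity)
    ?_ ?_ ?_ ?_ k 0 (by omega) u
  · rw [errM_eq]
    simp only [pow_zero, Matrix.one_mulVec, mul_one] at key
    refine key.trans_eq ?_
    ring
  · have : ((p + q) / 2 * d⁻¹ - (n : ℝ)⁻¹) * n = -(d - (p + q) / 2 * n) * d⁻¹ := by
      field_simp
      ring
    rw [← abs_of_pos hn0, ← abs_mul, abs_of_pos hn0, this, abs_mul, abs_neg,
      abs_of_pos (inv_pos.2 hd0)]
    calc _ ≤ (1 + C₀) * T * d⁻¹ := by gcongr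
      _ = (1 + C₀) * (T * d⁻¹) := by ring
      _ ≤ (1 + C₀) * (4 * ε) := by gcongr
      _ = _ := by ring
  · rw [abs_neg, abs_of_nonneg (by positivity)]
    calc p * d⁻¹ ≤ T * d⁻¹ := by gcongr; linarith
      _ ≤ 4 * ε := hTd
      _ ≤ _ := by nlinarith
  · intro m hm v
    rcases Nat.eq_zero_or_pos m with rfl | hm0
    · simp
    · rw [hpow]
      exact hscale m _ (hone v m hm0 (hmk m hm))
  · intro m hm v
    have hsn : 0 < √(n : ℝ) := Real.sqrt_pos.2 hn0
    have hmain : |((d⁻¹ • R) ^ m).mulVec (√n • sig n) v| ≤ (4 * C₀ * ε) ^ m := by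
      rcases Nat.eq_zero_or_pos m with rfl | hm0
      · simp only [pow_zero, Matrix.one_mulVec, Pi.smul_apply, sig, smul_eq_mul]
        split_ifs <;> simp [hsn.ne']
      · rw [hpow]
        exact hscale m _ (hsig v m hm0 (hmk m hm))
    rw [Matrix.mulVec_smul, Pi.smul_apply, smul_eq_mul, abs_mul, abs_of_pos hsn] at hmain
    rwa [← div_eq_inv_mul, le_div_iff₀' hsn]

/-- In the 2-block SBM with `p ≥ log³n/n`, with probability
`1 - n^{-Ω(1)}` simultaneously for all vertices `u` and all `k ∈ {1, …, O(log n)}`: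
`|e_uᵀ R'^k s| ≤ (1/√n)(C√(log n/(pn)))^k` for an absolute constant `C`. -/
theorem error_matrix_entrywise_bound :
    ∀ Ck : ℝ, 0 < Ck →
      ∃ (C c : ℝ) (n₀ : ℕ), 0 < C ∧ 0 < c ∧
        ∀ (n : ℕ) (p q : ℝ),
          n₀ ≤ n → Even n → 0 ≤ q → q < p → p ≤ 1 →
          (Real.log n) ^ 3 / n ≤ p →
          ENNReal.ofReal (1 - (n : ℝ) ^ (-c)) ≤
            sbm n p q
              {ω | ∀ (u : Fin n) (k : ℕ),
                1 ≤ k → (k : ℝ) ≤ Ck * Real.log n →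
                |((errM p q ω ^ k).mulVec (sig n)) u| ≤
                  (Real.sqrt n)⁻¹ * (C * Real.sqrt (Real.log n / (p * n))) ^ k} := by
  intro Ck hCk
  set C₀ : ℝ := 2 * √(2 * (1 + Ck)) * Real.exp 2 with hC₀
  have hC₀pos : 0 < C₀ := by
    have : 0 < √(2 * (1 + Ck)) := Real.sqrt_pos.2 (by positivity)
    positivity
  refine ⟨12 * C₀ + 8, 1, ⌈Real.exp (4 * (1 + C₀) + 2 * (1 + Ck) + Ck⁻¹)⌉₊, by positivity,
    one_pos, ?_⟩
  intro n p q hn heven hq hqp hp1 hp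
  have hp0 : 0 < p := hq.trans_lt hqp
  have hexp : Real.exp (4 * (1 + C₀) + 2 * (1 + Ck) + Ck⁻¹) ≤ n := Nat.ceil_le.1 hn
  have hn0 : (0 : ℝ) < n := (Real.exp_pos _).trans_le hexp
  have hlog : 4 * (1 + C₀) + 2 * (1 + Ck) + Ck⁻¹ ≤ Real.log n :=
    (Real.le_log_iff_exp_le hn0).2 hexp
  have hCkinv : 0 < Ck⁻¹ := inv_pos.2 hCk
  have hn1 : 1 < n := by
    by_contra h
    have : (n : ℝ) ≤ 1 := by exact_mod_cast not_lt.1 h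
    have := Real.log_nonpos hn0.le this
    linarith
  have hpn : Real.log n ^ 3 ≤ p * n := (div_le_iff₀ hn0).1 hp
  have hlogpn : 2 * (1 + Ck) * Real.log n ≤ p * n := by
    refine le_trans ?_ hpn
    calc 2 * (1 + Ck) * Real.log n ≤ Real.log n * Real.log n := by
          gcongr
          linarith
      _ ≤ Real.log n * Real.log n * Real.log n :=
          le_mul_of_one_le_right (by positivity) (by linarith)
      _ = _ := by ring
  have hCkL : 1 ≤ Ck * Real.log n := by
    calc 1 = Ck * Ck⁻¹ := (mul_inv_cancel₀ hCk.ne').symm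
      _ ≤ _ := by
        gcongr
        linarith
  have h0 : ∀ i j, 0 ≤ edgeProb n p q i j := fun i j => by
    unfold edgeProb; split_ifs <;> linarith
  have hP : ∀ i j, edgeProb n p q i j ≤ p := fun i j => by
    unfold edgeProb; split_ifs <;> linarith
  have hprob := isProbabilityMeasure_edgeLaw h0 fun i j => (hP i j).trans hp1
  have hsig : ∀ x, |(√n • sig n) x| ≤ 1 := fun x => by
    have hsn : 0 < √(n : ℝ) := Real.sqrt_pos.2 hn0
    simp only [Pi.smul_apply, sig, smul_eq_mul]
    split_ifs <;> simp [hsn.ne']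
  have hbad₁ := measureReal_exists_noise_pow_le h0 hP hp1 (f := fun _ => 1) (by simp) hCk hn1 hlogpn
  have hbad₂ := measureReal_exists_noise_pow_le h0 hP hp1 hsig hCk hn1 hlogpn
  rw [← hC₀] at hbad₁ hbad₂
  set bad₁ := {ω | ∃ (u : Fin n) (m : ℕ), 1 ≤ m ∧ (m : ℝ) ≤ Ck * Real.log n ∧
    (C₀ * √(p * n * Real.log n)) ^ m ≤
      |((noise (edgeProb n p q) ω ^ m).mulVec fun _ => 1) u|}
  set bad₂ := {ω | ∃ (u : Fin n) (m : ℕ), 1 ≤ m ∧ (m : ℝ) ≤ Ck * Real.log n ∧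
    (C₀ * √(p * n * Real.log n)) ^ m ≤
      |((noise (edgeProb n p q) ω ^ m).mulVec (√n • sig n)) u|}
  change _ ≤ edgeLaw (edgeProb n p q) _
  have hsub : (bad₁ ∪ bad₂)ᶜ ⊆ {ω | ∀ (u : Fin n) (k : ℕ), 1 ≤ k → (k : ℝ) ≤ Ck * Real.log n →
      |((errM p q ω ^ k).mulVec (sig n)) u| ≤
        (√n)⁻¹ * ((12 * C₀ + 8) * √(Real.log n / (p * n))) ^ k} := by
    intro ω hω u k _ hk
    rw [Set.compl_union] at hω
    refine abs_errM_pow_mulVec_le heven hq hp0 hp1 hC₀pos (by linarith) hpn hCkL ω ?_ ?_ u k hk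
    · intro v m hm hm'
      by_contra! h
      exact hω.1 ⟨v, m, hm, hm', h.le⟩
    · intro v m hm hm'
      by_contra! h
      exact hω.2 ⟨v, m, hm, hm', h.le⟩
  refine le_trans ?_ (measure_mono hsub)
  rw [← ofReal_measureReal, probReal_compl_eq_one_sub (Set.toFinite _).measurableSet]
  refine ENNReal.ofReal_le_ofReal (sub_le_sub_left ?_ 1)
  calc _ ≤ ((n : ℝ) ^ 2)⁻¹ + ((n : ℝ) ^ 2)⁻¹ :=
        (measureReal_union_le _ _).trans (add_le_add hbad₁ hbad₂)
    _ ≤ (n : ℝ)⁻¹ := by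
        have : (2 : ℝ) ≤ n := by exact_mod_cast hn1
        field_simp
        linarith
    _ = _ := (Real.rpow_neg_one _).symm
end

section
/- Let R be an n×n symmetric random matrix where for each i ≤ j independently, R_{i,j} = 1 − p_{i,j} with probability p_{i,j} and R_{i,j} = −p_{i,j} with probability 1 − p_{i,j}; let p = max_{i,j} p_{i,j} and suppose p ≥ Ω(log³n / n). Let s ∈ ℝ^n have all entries of absolute value 1/√n, let u be a vertex, and let k = O(log n). Then Pr[ |e_uᵀ R^k s| > (1/√n)·(C√(np·log n))^k ] ≤ exp(−Ω(C·log n)) for a sufficiently large constant C. -/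
open MeasureTheory ProbabilityTheory Matrix

/-- Randomness for the centered random matrix: an independent Bernoulli variable of
parameter `pm i j` for each pair; only the upper triangle is used. -/
noncomputable def bernM (n : ℕ) (pm : Fin n → Fin n → ℝ) :
    Measure (Fin n → Fin n → Bool) :=
  Measure.pi fun i => Measure.pi fun j => bern (pm i j)

/-- The symmetric random matrix `R` with `R_{ij} = 1 - p_{ij}` with probability
`p_{ij}` and `R_{ij} = -p_{ij}` otherwise, independently for `i ≤ j`. -/
noncomputable def Rmat {n : ℕ} (pm : Fin n → Fin n → ℝ) (ω : Fin n → Fin n → Bool) :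
    Matrix (Fin n) (Fin n) ℝ :=
  Matrix.of fun i j =>
    if i ≤ j then (if ω i j then 1 - pm i j else -pm i j)
    else (if ω j i then 1 - pm j i else -pm j i)

/-- The canonical ordered representative of the unordered pair `{v, x}`. -/
def orderedPair {n : ℕ} (v x : Fin n) : Fin n × Fin n :=
  if v ≤ x then (v, x) else (x, v)

lemma orderedPair_injective {n : ℕ} (v : Fin n) : Function.Injective (orderedPair v) := by
  intro x y h
  unfold orderedPair at h
  split_ifs at h <;> simp only [Prod.mk.injEq] at h <;> obtain ⟨h1, h2⟩ := h <;> grind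

/-- A Bernoulli value centered at its mean `p`. -/
def centered (p : ℝ) (b : Bool) : ℝ := if b then 1 - p else -p

lemma Rmat_apply {n : ℕ} (pm : Fin n → Fin n → ℝ) (ω : Fin n → Fin n → Bool) (v x : Fin n) :
    Rmat pm ω v x = centered (pm (orderedPair v x).1 (orderedPair v x).2)
      (ω (orderedPair v x).1 (orderedPair v x).2) := by
  unfold Rmat orderedPair centered
  by_cases h : v ≤ x <;> simp [h]

instance (p : ℝ) : IsFiniteMeasure (bern p) := by
  constructor
  simp [bern]

instance (n : ℕ) (pm : Fin n → Fin n → ℝ) : IsFiniteMeasure (bernM n pm) := by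
  unfold bernM
  infer_instance

lemma integral_centered {p : ℝ} (h0 : 0 ≤ p) (h1 : p ≤ 1) :
    ∫ b, centered p b ∂(bern p) = 0 := by
  rw [integral_bern h0 h1]
  simp only [centered, Bool.false_eq_true, if_false, if_true]
  ring

lemma abs_integral_centered_pow_le_s14 {p : ℝ} (h0 : 0 ≤ p) (h1 : p ≤ 1) {c : ℕ} (hc : 2 ≤ c) :
    |∫ b, centered p b ^ c ∂(bern p)| ≤ p := by
  rw [integral_bern h0 h1]
  simp only [centered, Bool.false_eq_true, if_false, if_true]
  have hq : 0 ≤ 1 - p := by linarith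
  have e1 : p ^ c ≤ p ^ 2 := pow_le_pow_of_le_one h0 h1 hc
  have e2 : (1 - p) ^ c ≤ (1 - p) ^ 2 := pow_le_pow_of_le_one hq (by linarith) hc
  calc |(1 - p) * (-p) ^ c + p * (1 - p) ^ c|
      ≤ |(1 - p) * (-p) ^ c| + |p * (1 - p) ^ c| := abs_add_le _ _
    _ = (1 - p) * p ^ c + p * (1 - p) ^ c := by
        rw [abs_mul, abs_mul, abs_pow, abs_pow, abs_neg, abs_of_nonneg h0, abs_of_nonneg hq]
    _ ≤ (1 - p) * p ^ 2 + p * (1 - p) ^ 2 := by gcongr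
    _ ≤ p := by nlinarith

/-- The product of the centered entries at the positions listed in `l`. -/
def edgeProd {n : ℕ} (pm : Fin n → Fin n → ℝ) (l : List (Fin n × Fin n))
    (ω : Fin n → Fin n → Bool) : ℝ :=
  (l.map fun e => centered (pm e.1 e.2) (ω e.1 e.2)).prod

lemma integral_edgeProd {n : ℕ} (pm : Fin n → Fin n → ℝ) (l : List (Fin n × Fin n)) :
    ∫ ω, edgeProd pm l ω ∂(bernM n pm) =
      ∏ e : Fin n × Fin n, ∫ b, centered (pm e.1 e.2) b ^ l.count e ∂(bern (pm e.1 e.2)) := by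
  have h : ∀ ω, edgeProd pm l ω =
      ∏ i, ∏ j, centered (pm i j) (ω i j) ^ l.count (i, j) := by
    intro ω
    rw [edgeProd, Finset.prod_list_map_count, ← Fintype.prod_prod_type
      (f := fun e : Fin n × Fin n => centered (pm e.1 e.2) (ω e.1 e.2) ^ l.count e)]
    have := Finset.prod_subset (Finset.subset_univ l.toFinset)
      (f := fun e : Fin n × Fin n => centered (pm e.1 e.2) (ω e.1 e.2) ^ l.count e)
      fun e _ he => by
        rw [List.count_eq_zero_of_not_mem (by simpa using he), pow_zero]
    convert this
  simp_rw [h]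
  unfold bernM
  rw [integral_fintype_prod_eq_prod (𝕜 := ℝ)
    (f := fun i (x : Fin n → Bool) => ∏ j, centered (pm i j) (x j) ^ l.count (i, j))]
  rw [Fintype.prod_prod_type]
  refine Finset.prod_congr rfl fun i _ => ?_
  rw [integral_fintype_prod_eq_prod (𝕜 := ℝ)
    (f := fun j (x : Bool) => centered (pm i j) x ^ l.count (i, j))]

lemma two_mul_card_toFinset_le_length {α : Type*} [DecidableEq α] (l : List α)
    (h : ∀ a ∈ l, 2 ≤ l.count a) : 2 * l.toFinset.card ≤ l.length := by
  rw [← List.sum_toFinset_count_eq_length l, mul_comm, ← smul_eq_mul]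
  exact Finset.card_nsmul_le_sum _ _ _ fun a ha => h a (by simpa using ha)

lemma abs_integral_edgeProd_le {n : ℕ} {pm : Fin n → Fin n → ℝ} {p z r : ℝ} {N : ℕ}
    (hpm : ∀ i j, 0 ≤ pm i j ∧ pm i j ≤ 1) (hp : ∀ i j, pm i j ≤ p) (hp0 : 0 ≤ p)
    (hz : 0 ≤ z) (hr : 1 ≤ r) (hpz : p ≤ r * z) (l : List (Fin n × Fin n))
    (hl : l.length ≤ 2 * N) :
    |∫ ω, edgeProd pm l ω ∂(bernM n pm)| ≤ r ^ N * z ^ l.toFinset.card := by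
  rw [integral_edgeProd, Finset.abs_prod]
  by_cases h : ∀ a ∈ l, 2 ≤ l.count a
  · have hd : l.toFinset.card ≤ N := by
      have := two_mul_card_toFinset_le_length l fun a ha => by convert h a ha
      omega
    calc _ = ∏ e ∈ l.toFinset,
          |∫ b, centered (pm e.1 e.2) b ^ l.count e ∂(bern (pm e.1 e.2))| := by
          symm
          refine Finset.prod_subset (Finset.subset_univ _) fun e _ he => ?_
          rw [List.count_eq_zero_of_not_mem (by simpa using he),
            integral_bern (hpm _ _).1 (hpm _ _).2]
          simp
      _ ≤ ∏ e ∈ l.toFinset, p := by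
          refine Finset.prod_le_prod (fun _ _ => abs_nonneg _) fun e he => ?_
          exact (abs_integral_centered_pow_le_s14 (hpm _ _).1 (hpm _ _).2
            (h e (by simpa using he))).trans (hp _ _)
      _ = p ^ l.toFinset.card := by simp
      _ ≤ (r * z) ^ l.toFinset.card := by gcongr
      _ = r ^ l.toFinset.card * z ^ l.toFinset.card := mul_pow _ _ _
      _ ≤ r ^ N * z ^ l.toFinset.card := by gcongr
  · push Not at h
    obtain ⟨a, ha, hc⟩ := h
    have h1 : l.count a = 1 := by
      have := List.count_pos_iff.2 ha
      omega
    rw [Finset.prod_eq_zero (Finset.mem_univ a)]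
    · positivity
    · rw [h1]
      simp only [pow_one]
      rw [integral_centered (hpm _ _).1 (hpm _ _).2, abs_zero]

lemma sum_pow_card_insert_le {n : ℕ} {α : Type*} [DecidableEq α] {f : Fin n → α}
    (hf : Function.Injective f) {z : ℝ} (hz : 0 ≤ z) (S : Finset α) {L : ℕ} (hS : S.card ≤ L) :
    ∑ x, z ^ (insert (f x) S).card ≤ z ^ S.card * (L + n * z) := by
  have h : ∀ x, z ^ (insert (f x) S).card ≤ z ^ S.card * ((if f x ∈ S then 1 else 0) + z) := by
    intro x
    have : 0 ≤ z ^ S.card := by positivity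
    split_ifs with hx
    · rw [Finset.insert_eq_of_mem hx]
      nlinarith
    · rw [Finset.card_insert_of_notMem hx, zero_add, pow_succ]
  refine (Finset.sum_le_sum fun x _ => h x).trans ?_
  rw [← Finset.mul_sum, Finset.sum_add_distrib, Finset.sum_boole]
  have hc : (Finset.univ.filter fun x => f x ∈ S).card ≤ L :=
    (Finset.card_le_card_of_injOn f (fun x hx => by simpa using hx) hf.injOn).trans hS
  have hc' : ((Finset.univ.filter fun x => f x ∈ S).card : ℝ) ≤ L := by exact_mod_cast hc
  simp only [Finset.sum_const, Finset.card_univ, Fintype.card_fin, nsmul_eq_mul]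
  gcongr

lemma abs_integral_edgeProd_mul_step_le {n L j : ℕ} {pm : Fin n → Fin n → ℝ} {z A : ℝ}
    {s : Fin n → ℝ} {F : (Fin n → Fin n → Bool) → ℝ} {v : Fin n} {l : List (Fin n × Fin n)}
    (hz : 0 ≤ z) (hA : 0 ≤ A) (hl : l.length ≤ L)
    (h : ∀ x, |∫ ω, edgeProd pm (orderedPair v x :: l) ω * ((Rmat pm ω ^ j).mulVec s) x * F ω
      ∂(bernM n pm)| ≤ A * z ^ (orderedPair v x :: l).toFinset.card) :
    |∫ ω, edgeProd pm l ω * ((Rmat pm ω ^ (j + 1)).mulVec s) v * F ω ∂(bernM n pm)| ≤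
      A * (z ^ l.toFinset.card * (L + n * z)) := by
  have e : ∀ ω, edgeProd pm l ω * ((Rmat pm ω ^ (j + 1)).mulVec s) v * F ω =
      ∑ x, edgeProd pm (orderedPair v x :: l) ω * ((Rmat pm ω ^ j).mulVec s) x * F ω := by
    intro ω
    rw [pow_succ', ← Matrix.mulVec_mulVec, Matrix.mulVec, dotProduct, Finset.mul_sum,
      Finset.sum_mul]
    refine Finset.sum_congr rfl fun x _ => ?_
    rw [Rmat_apply]
    simp only [edgeProd, List.map_cons, List.prod_cons]
    ring
  simp_rw [e]
  rw [integral_finsetSum _ fun _ _ => .of_finite]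
  calc _ ≤ ∑ x, A * z ^ (orderedPair v x :: l).toFinset.card :=
        (Finset.abs_sum_le_sum_abs _ _).trans (Finset.sum_le_sum fun x _ => h x)
    _ = A * ∑ x, z ^ (insert (orderedPair v x) l.toFinset).card := by
        simp [Finset.mul_sum, List.toFinset_cons]
    _ ≤ _ := by
        gcongr
        exact sum_pow_card_insert_le (orderedPair_injective v) hz _
          ((List.toFinset_card_le l).trans hl)

/-- Revealing the remaining steps one at a time: `j` steps of the current walk, standing at `v`,
and `m` further walks of length `k` from `u`, after the edges of `l` have been traversed. -/
lemma abs_integral_edgeProd_mul_walks_le {n k N : ℕ} {pm : Fin n → Fin n → ℝ} {p z r σ : ℝ}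
    {s : Fin n → ℝ} (u : Fin n)
    (hpm : ∀ i j, 0 ≤ pm i j ∧ pm i j ≤ 1) (hp : ∀ i j, pm i j ≤ p) (hp0 : 0 ≤ p)
    (hz : 0 ≤ z) (hr : 1 ≤ r) (hpz : p ≤ r * z) (hs : ∀ i, |s i| = σ) (m : ℕ) :
    ∀ (j : ℕ) (v : Fin n) (l : List (Fin n × Fin n)), l.length + j + m * k ≤ 2 * N →
      |∫ ω, edgeProd pm l ω * ((Rmat pm ω ^ j).mulVec s) v *
          (((Rmat pm ω ^ k).mulVec s) u) ^ m ∂(bernM n pm)| ≤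
        σ ^ (m + 1) * r ^ N * ((2 * N : ℕ) + n * z) ^ (j + m * k) * z ^ l.toFinset.card := by
  have hσ : 0 ≤ σ := (hs u) ▸ abs_nonneg _
  induction m with
  | zero =>
    intro j
    induction j with
    | zero =>
      intro v l hl
      have := abs_integral_edgeProd_le hpm hp hp0 hz hr hpz l (N := N) (by omega)
      simp only [pow_zero, Matrix.one_mulVec, mul_one, integral_mul_const, abs_mul, hs]
      simp only [zero_mul, add_zero, pow_zero, mul_one, zero_add, pow_one]
      rw [mul_comm, mul_assoc]
      gcongr
    | succ j ih =>
      intro v l hl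
      refine (abs_integral_edgeProd_mul_step_le (L := 2 * N) hz ?_ (by omega)
        fun x => ih x _ ?_).trans_eq ?_
      · positivity
      · simp only [List.length_cons]
        omega
      · ring
  | succ m ihm =>
    intro j
    induction j with
    | zero =>
      intro v l hl
      have := ihm k u l (by rw [add_mul] at hl; omega)
      have e : ∀ ω, edgeProd pm l ω * ((Rmat pm ω ^ 0).mulVec s) v *
          (((Rmat pm ω ^ k).mulVec s) u) ^ (m + 1) =
          (edgeProd pm l ω * ((Rmat pm ω ^ k).mulVec s) u *
            (((Rmat pm ω ^ k).mulVec s) u) ^ m) * s v := by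
        intro ω
        rw [pow_zero, Matrix.one_mulVec]
        ring
      simp_rw [e]
      rw [integral_mul_const, abs_mul, hs]
      refine (mul_le_mul_of_nonneg_right this hσ).trans_eq ?_
      ring
    | succ j ih =>
      intro v l hl
      refine (abs_integral_edgeProd_mul_step_le (L := 2 * N) hz ?_ (by omega)
        fun x => ih x _ ?_).trans_eq ?_
      · positivity
      · simp only [List.length_cons]
        omega
      · ring

/-- The moment bound for the value at `u` of `R ^ k` applied to a flat vector. -/
lemma integral_mulVec_pow_le {n k q N : ℕ} {pm : Fin n → Fin n → ℝ} {p z r σ : ℝ}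
    {s : Fin n → ℝ} (u : Fin n)
    (hpm : ∀ i j, 0 ≤ pm i j ∧ pm i j ≤ 1) (hp : ∀ i j, pm i j ≤ p) (hp0 : 0 ≤ p)
    (hz : 0 ≤ z) (hr : 1 ≤ r) (hpz : p ≤ r * z) (hs : ∀ i, |s i| = σ) (hq : 0 < q)
    (hN : q * k = N) :
    ∫ ω, (((Rmat pm ω ^ k).mulVec s) u) ^ (2 * q) ∂(bernM n pm) ≤
      σ ^ (2 * q) * (r * (2 * N + n * z) ^ 2) ^ N := by
  obtain ⟨m, hm⟩ : ∃ m, 2 * q = m + 1 := ⟨2 * q - 1, by omega⟩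
  have hk : k + m * k = 2 * N := by rw [← hN, ← mul_assoc, hm]; ring
  have h := abs_integral_edgeProd_mul_walks_le (k := k) (N := N) u hpm hp hp0 hz hr hpz hs m k u []
    (by simp [hk])
  rw [hk] at h
  simp only [edgeProd, List.map_nil, List.prod_nil, one_mul, List.toFinset_nil,
    Finset.card_empty, pow_zero, mul_one, ← pow_succ'] at h
  rw [hm]
  refine (le_abs_self _).trans (h.trans_eq ?_)
  rw [mul_pow, ← pow_mul]
  push_cast
  ring

lemma measureReal_lt_abs_le {Ω : Type*} [Finite Ω] [MeasurableSpace Ω]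
    [MeasurableSingletonClass Ω] (μ : Measure Ω) [IsFiniteMeasure μ] (X : Ω → ℝ) {t B : ℝ}
    (ht : 0 < t) (q : ℕ) (h : ∫ ω, X ω ^ (2 * q) ∂μ ≤ B) :
    μ.real {ω | t < |X ω|} ≤ B / t ^ (2 * q) := by
  rw [le_div_iff₀ (by positivity), mul_comm]
  refine le_trans ?_ ((mul_meas_ge_le_integral_of_nonneg (μ := μ) (f := fun ω => X ω ^ (2 * q))
    (.of_forall fun ω => (even_two_mul q).pow_nonneg _) .of_finite (t ^ (2 * q))).trans h)
  gcongr
  · exact measure_ne_top _ _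
  · rename_i ω
    intro hω
    rw [← (even_two_mul q).pow_abs (X ω)]
    gcongr

/-- For the centered Bernoulli random matrix `R` with
`p = max_{ij} p_{ij} ≥ Ω(log³n/n)`, `s` with entries of absolute value `1/√n`,
a vertex `u` and `k = O(log n)`:
`Pr[|e_uᵀ R^k s| > (1/√n)(C√(np log n))^k] ≤ exp(-Ω(C log n))` for all sufficiently
large constants `C`. -/
theorem message_passing_bound :
    ∀ Ck : ℝ, 0 < Ck →
      ∃ (Cp C₀ c : ℝ) (n₀ : ℕ), 0 < Cp ∧ 0 < C₀ ∧ 0 < c ∧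
        ∀ (n k : ℕ) (pm : Fin n → Fin n → ℝ) (p : ℝ) (s : Fin n → ℝ) (u : Fin n)
          (C : ℝ),
          n₀ ≤ n → C₀ ≤ C →
          (∀ i j, 0 ≤ pm i j ∧ pm i j ≤ 1) →
          (∀ i j, pm i j ≤ p) → (∃ i j, pm i j = p) →
          Cp * (Real.log n) ^ 3 / n ≤ p →
          (k : ℝ) ≤ Ck * Real.log n →
          (∀ i, |s i| = (Real.sqrt n)⁻¹) →
          bernM n pm
              {ω | (Real.sqrt n)⁻¹ *
                    (C * Real.sqrt (n * p * Real.log n)) ^ k <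
                  |((Rmat pm ω ^ k).mulVec s) u|} ≤
            ENNReal.ofReal (Real.exp (-(c * C * Real.log n))) := by
  intro Ck hCk
  refine ⟨192, max 48 Ck, 1, 3, by norm_num, by positivity, one_pos, ?_⟩
  intro n k pm p s u C hn hC hpm hp hp_ex hp_lb hk hs
  have hC48 : 48 ≤ C := (le_max_left _ _).trans hC
  have hCCk : Ck ≤ C := (le_max_right _ _).trans hC
  rcases Nat.eq_zero_or_pos k with rfl | hkpos
  · simp [hs]
  have hn3 : (3 : ℝ) ≤ n := by exact_mod_cast hn
  have hn0 : (0 : ℝ) < n := by linarith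
  set lg := Real.log n with hlg
  have hlg1 : 1 ≤ lg := by
    rw [hlg, Real.le_log_iff_exp_le hn0]
    exact (Real.exp_one_lt_three.le).trans hn3
  have hnp : 192 * lg ^ 3 ≤ n * p := by
    rw [div_le_iff₀ hn0] at hp_lb
    linarith
  have hnp' : 192 * lg ≤ n * p := by
    have : lg ≤ lg ^ 3 := le_self_pow₀ hlg1 (by norm_num)
    linarith
  have hnp0 : 0 < n * p := by linarith
  have hp0 : 0 < p := pos_of_mul_pos_right hnp0 hn0.le
  have hk0 : (0 : ℝ) < k := by exact_mod_cast hkpos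
  set q := ⌈C * lg / k⌉₊ with hq
  have hqpos : 0 < q := Nat.ceil_pos.2 (by positivity)
  set N := q * k with hN
  have hN1 : C * lg ≤ N := by
    rw [hN, Nat.cast_mul, ← div_le_iff₀ hk0]
    exact Nat.le_ceil _
  have hN2 : (N : ℝ) ≤ 2 * C * lg := by
    have h1 : (q : ℝ) < C * lg / k + 1 := Nat.ceil_lt_add_one (by positivity)
    have h2 : (q : ℝ) * k ≤ C * lg + k := by
      calc (q : ℝ) * k ≤ (C * lg / k + 1) * k := by gcongr
        _ = C * lg + k := by field_simp
    have h3 : Ck * lg ≤ C * lg := by gcongr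
    rw [hN, Nat.cast_mul]
    linarith
  have hN0 : (0 : ℝ) < N := lt_of_lt_of_le (by positivity) hN1
  set r := max 1 (n * p / (2 * N)) with hr
  set D := C ^ 2 * (n * p * lg) with hD
  have hD0 : 0 < D := by positivity
  have hmom := integral_mulVec_pow_le (k := k) (q := q) (N := N) (z := 2 * N / n) (r := r) u hpm hp
    hp0.le (by positivity) (le_max_left _ _) ?_ hs hqpos rfl
  swap
  · calc p = n * p / (2 * N) * (2 * N / n) := by field_simp
      _ ≤ r * (2 * N / n) := by gcongr; exact le_max_right _ _
  have hbase : r * (2 * N + n * (2 * N / n)) ^ 2 ≤ D * Real.exp (-1) := by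
    have e1 : (2 * N + n * (2 * N / n) : ℝ) = 4 * N := by field_simp; ring
    rw [e1, hr, max_mul_of_nonneg _ _ (by positivity), Real.exp_neg, ← div_eq_mul_inv,
      le_div_iff₀ (Real.exp_pos _)]
    refine (mul_le_mul_of_nonneg_left Real.exp_one_lt_three.le (by positivity)).trans ?_
    rw [max_mul_of_nonneg _ _ (by norm_num)]
    refine max_le ?_ ?_
    · calc 1 * (4 * N : ℝ) ^ 2 * 3 ≤ 1 * (4 * (2 * C * lg)) ^ 2 * 3 := by gcongr
        _ = C ^ 2 * (192 * lg * lg) := by ring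
        _ ≤ D := by rw [hD]; gcongr
    · calc n * p / (2 * N) * (4 * N : ℝ) ^ 2 * 3 = 24 * (n * p) * N := by field_simp; ring
        _ ≤ 24 * (n * p) * (2 * C * lg) := by gcongr
        _ = 48 * (C * (n * p * lg)) := by ring
        _ ≤ C * (C * (n * p * lg)) := by gcongr
        _ = D := by rw [hD]; ring
  set t := (Real.sqrt n)⁻¹ * (C * Real.sqrt (n * p * lg)) ^ k with ht
  have ht0 : 0 < t := by positivity
  have htpow : t ^ (2 * q) = (Real.sqrt n)⁻¹ ^ (2 * q) * D ^ N := by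
    rw [ht, mul_pow, ← pow_mul, show k * (2 * q) = 2 * N by rw [hN]; ring, pow_mul _ 2 N,
      mul_pow C, Real.sq_sqrt (by positivity)]
  have hfin := measureReal_lt_abs_le (bernM n pm) (fun ω => ((Rmat pm ω ^ k).mulVec s) u)
    ht0 q hmom
  rw [← ofReal_measureReal]
  refine ENNReal.ofReal_le_ofReal (hfin.trans ?_)
  rw [div_le_iff₀ (by positivity), htpow]
  calc _ ≤ (Real.sqrt n)⁻¹ ^ (2 * q) * (D * Real.exp (-1)) ^ N := by gcongr
    _ = Real.exp (-N) * ((Real.sqrt n)⁻¹ ^ (2 * q) * D ^ N) := by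
        rw [mul_pow D, ← Real.exp_nat_mul]
        ring_nf
    _ ≤ Real.exp (-(1 * C * lg)) * ((Real.sqrt n)⁻¹ ^ (2 * q) * D ^ N) := by
        gcongr
        linarith
end

section
/- Fix a vertex u and integers k, t, ℓ with t ≤ log n/(2k). Let 𝒲 be the set of walks of length k starting at u in the complete graph on n vertices, and let 𝒲_pair^{2t} be the set of 2t-tuples (w₁,...,w_{2t}) ∈ 𝒲^{2t} such that, in the multigraph formed by the union of the edges traversed by the 2t walks, every edge occurs at least twice. Then the number of tuples in 𝒲_pair^{2t} whose union contains exactly ℓ distinct edges is at most binom(2tk, 2ℓ) · (2ℓ−1)!! · ℓ^{2kt−2ℓ} · n^ℓ. -/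
/-- The multiset of (unordered) edges traversed by a tuple of `T` walks of length `k`
on the vertex set `Fin n`, counted with multiplicity over all walks and steps. -/
def walkEdges {n k T : ℕ} (W : Fin T → Fin (k + 1) → Fin n) : Multiset (Sym2 (Fin n)) :=
  (Finset.univ ×ˢ Finset.univ : Finset (Fin T × Fin k)).val.map
    fun ij => s(W ij.1 ij.2.castSucc, W ij.1 ij.2.succ)

/-- The number of pairs of an embedding `g` and a labelling `c` such that `c` labels `g (i, b)`
by `i`. -/
theorem card_marked_labellings_le {P : Type*} [Fintype P] [DecidableEq P] (ℓ : ℕ) :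
    (Finset.univ.filter fun x : (Fin ℓ × Bool ↪ P) × (P → Fin ℓ) =>
        ∀ y, x.2 (x.1 y) = y.1).card ≤
      (Fintype.card P).descFactorial (2 * ℓ) * ℓ ^ (Fintype.card P - 2 * ℓ) := by
  classical
  have hcard : Fintype.card (Σ g : Fin ℓ × Bool ↪ P, ({p // p ∉ Set.range g} → Fin ℓ)) =
      (Fintype.card P).descFactorial (2 * ℓ) * ℓ ^ (Fintype.card P - 2 * ℓ) := by
    rw [Fintype.card_sigma, Finset.sum_congr rfl
      (g := fun _ => ℓ ^ (Fintype.card P - 2 * ℓ))]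
    · simp [Fintype.card_embedding_eq, mul_comm ℓ 2]
    · intro g _
      have h : Fintype.card {p // p ∈ Set.range g} = 2 * ℓ := by
        rw [← Fintype.card_congr (Equiv.ofInjective g g.injective)]
        simp [mul_comm]
      rw [Fintype.card_fun, Fintype.card_fin, Fintype.card_subtype_compl, h]
  rw [← hcard, ← Finset.card_univ]
  refine Finset.card_le_card_of_injOn (fun x => ⟨x.1, fun p => x.2 p⟩)
    (fun _ _ => Finset.mem_coe.2 (Finset.mem_univ _)) ?_
  rintro ⟨g, c⟩ hc ⟨g', c'⟩ hc' h
  simp only [Finset.coe_filter, Finset.mem_univ, true_and, Set.mem_ofPred_eq] at hc hc'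
  obtain ⟨rfl, h⟩ := Sigma.mk.inj_iff.1 h
  refine Prod.ext rfl (funext fun p => ?_)
  by_cases hp : p ∈ Set.range g
  · obtain ⟨y, rfl⟩ := hp
    exact (hc y).trans (hc' y).symm
  · exact congrFun (eq_of_heq h) ⟨p, hp⟩

/-- A labelling that meets every label at least twice yields, by permuting labels and swapping
marked elements, at least `ℓ! * 2 ^ ℓ` marked labellings with the same classes. -/
theorem factorial_mul_two_pow_le_card_marked_labellings {P : Type*} [Fintype P] [DecidableEq P]
    {ℓ : ℕ} (c : P → Fin ℓ) (hc : ∀ i, ∃ p q, p ≠ q ∧ c p = i ∧ c q = i) :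
    ℓ.factorial * 2 ^ ℓ ≤ (Finset.univ.filter fun x : (Fin ℓ × Bool ↪ P) × (P → Fin ℓ) =>
      (∀ y, x.2 (x.1 y) = y.1) ∧ ∀ p q, x.2 p = x.2 q → c p = c q).card := by
  choose a b hab ha hb using hc
  have hg : ∀ i (x : Bool), c (if x then a i else b i) = i := by
    intro i x
    cases x <;> simp [ha, hb]
  have hinj : ∀ i j (x y : Bool), (if x then a i else b i) = (if y then a j else b j) →
      i = j ∧ x = y := by
    intro i j x y h
    obtain rfl : i = j := by rw [← hg i x, h, hg]
    refine ⟨rfl, ?_⟩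
    have h₁ := hab i
    have h₂ := h₁.symm
    cases x <;> cases y <;> simp_all
  let F : Equiv.Perm (Fin ℓ) × (Fin ℓ → Bool) → (Fin ℓ × Bool ↪ P) × (P → Fin ℓ) := fun s =>
    (⟨fun y => if xor y.2 (s.2 y.1) then a (s.1.symm y.1) else b (s.1.symm y.1), by
      rintro ⟨i, x⟩ ⟨j, y⟩ h
      obtain ⟨h₁, h₂⟩ := hinj _ _ _ _ h
      obtain rfl : i = j := by simpa using h₁
      simpa using h₂⟩, fun p => s.1 (c p))
  have hF : Function.Injective F := by
    rintro ⟨π, s⟩ ⟨π', s'⟩ h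
    obtain ⟨h₁, h₂⟩ := Prod.mk_inj.1 h
    obtain rfl : π = π' := Equiv.ext fun i => by simpa [ha] using congrFun h₂ (a i)
    refine Prod.ext rfl (funext fun i => ?_)
    have := (hinj _ _ _ _ (DFunLike.congr_fun h₁ (i, false))).2
    simpa using this
  calc ℓ.factorial * 2 ^ ℓ
      = (Finset.univ : Finset (Equiv.Perm (Fin ℓ) × (Fin ℓ → Bool))).card := by
        simp [Fintype.card_perm]
    _ ≤ _ := Finset.card_le_card_of_injOn F (fun s _ => by
        refine Finset.mem_coe.2 (Finset.mem_filter.2 ⟨Finset.mem_univ _, fun y => ?_,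
          fun p q h => s.1.injective h⟩)
        exact (congrArg s.1 (hg _ _)).trans (s.1.apply_symm_apply _)) hF.injOn

/-- Walks from `u` whose steps traverse equal edges whenever they carry equal labels are
determined by the vertices entered at the first occurrence of each label. -/
theorem card_walks_compatible_le {n k T ℓ : ℕ} (u : Fin n) (c : Fin T × Fin k → Fin ℓ)
    (hc : Function.Surjective c) (S : Finset (Fin T → Fin (k + 1) → Fin n))
    (hu : ∀ W ∈ S, ∀ i, W i 0 = u)
    (hS : ∀ W ∈ S, ∀ p q, c p = c q → s(W p.1 p.2.castSucc, W p.1 p.2.succ) =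
      s(W q.1 q.2.castSucc, W q.1 q.2.succ)) :
    S.card ≤ n ^ ℓ := by
  classical
  have hm : ∀ i, ∃ p, c p = i ∧ ∀ q, c q = i → toLex p ≤ toLex q := by
    intro i
    obtain ⟨p₀, hp₀⟩ := hc i
    obtain ⟨p, hp, hle⟩ := Finset.exists_min_image (Finset.univ.filter fun p => c p = i) toLex
      ⟨p₀, by simpa using hp₀⟩
    exact ⟨p, by simpa using hp, fun q hq => hle q (by simpa using hq)⟩
  choose m hm hle using hm
  have key : Set.InjOn (fun (W : Fin T → Fin (k + 1) → Fin n) i =>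
      W (m i).1 (m i).2.succ) (S : Set (Fin T → Fin (k + 1) → Fin n)) := by
    intro W hW W' hW' h
    rw [Finset.mem_coe] at hW hW'
    have step : ∀ p : Fin T ×ₗ Fin k,
        W (ofLex p).1 (ofLex p).2.castSucc = W' (ofLex p).1 (ofLex p).2.castSucc ∧
        W (ofLex p).1 (ofLex p).2.succ = W' (ofLex p).1 (ofLex p).2.succ := by
      intro p
      induction p using WellFoundedLT.induction with
      | ind p ih =>
        obtain ⟨⟨i, j⟩, rfl⟩ := toLex.surjective p
        simp only [ofLex_toLex]
        have h₁ : W i j.castSucc = W' i j.castSucc := by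
          obtain ⟨j, hj⟩ := j
          cases j with
          | zero => exact (hu W hW i).trans (hu W' hW' i).symm
          | succ j =>
            exact (ih (toLex (i, ⟨j, by omega⟩))
              (Prod.Lex.toLex_lt_toLex.2 (Or.inr ⟨rfl, by simp⟩))).2
        refine ⟨h₁, ?_⟩
        rcases (hle (c (i, j)) (i, j) rfl).eq_or_lt with he | hlt
        · have := congrFun h (c (i, j))
          simpa [toLex.injective he] using this
        · obtain ⟨ih₁, ih₂⟩ := ih _ hlt
          simp only [ofLex_toLex] at ih₁ ih₂
          have e := hS W hW _ _ (hm (c (i, j)))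
          have e' := hS W' hW' _ _ (hm (c (i, j)))
          rw [ih₁, ih₂, e', h₁] at e
          exact (Sym2.congr_right.1 e).symm
    funext i j
    cases j using Fin.cases with
    | zero => rw [hu W hW, hu W' hW']
    | succ j => exact (step (toLex (i, j))).2
  calc S.card ≤ (Finset.univ : Finset (Fin ℓ → Fin n)).card :=
        Finset.card_le_card_of_injOn _ (fun _ _ => by simp) key
    _ = n ^ ℓ := by simp

/-- If every traversed edge is traversed at least twice, the steps can be labelled by their
edges, each label occurring at least twice. -/
theorem exists_edge_labelling {n k T ℓ : ℕ} (W : Fin T → Fin (k + 1) → Fin n)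
    (h₂ : ∀ e ∈ walkEdges W, 2 ≤ (walkEdges W).count e)
    (hℓ : (walkEdges W).toFinset.card = ℓ) :
    ∃ c : Fin T × Fin k → Fin ℓ, (∀ i, ∃ p q, p ≠ q ∧ c p = i ∧ c q = i) ∧
      ∀ p q, c p = c q → s(W p.1 p.2.castSucc, W p.1 p.2.succ) =
        s(W q.1 q.2.castSucc, W q.1 q.2.succ) := by
  classical
  have hmem : ∀ p : Fin T × Fin k,
      s(W p.1 p.2.castSucc, W p.1 p.2.succ) ∈ (walkEdges W).toFinset := by
    intro p
    rw [Multiset.mem_toFinset, walkEdges]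
    exact Multiset.mem_map.2 ⟨p, by simp, rfl⟩
  let e := (walkEdges W).toFinset.equivFinOfCardEq hℓ
  refine ⟨fun p => e ⟨_, hmem p⟩, fun i => ?_, fun p q h => ?_⟩
  · obtain ⟨⟨x, hx⟩, rfl⟩ := e.surjective i
    have h := h₂ x (Multiset.mem_toFinset.1 hx)
    rw [walkEdges, Multiset.count_map, ← Finset.filter_val, Finset.card_val] at h
    obtain ⟨p, hp, q, hq, hpq⟩ := Finset.one_lt_card.1 h
    rw [Finset.mem_filter] at hp hq
    refine ⟨p, q, hpq, ?_, ?_⟩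
    · exact congrArg e (Subtype.ext hp.2.symm)
    · exact congrArg e (Subtype.ext hq.2.symm)
  · exact congrArg Subtype.val (e.injective h)

theorem factorial_two_mul_eq (ℓ : ℕ) :
    (2 * ℓ).factorial = ℓ.factorial * 2 ^ ℓ * (2 * ℓ - 1).doubleFactorial := by
  cases ℓ with
  | zero => rfl
  | succ m =>
    have h := Nat.factorial_eq_mul_doubleFactorial (2 * m + 1)
    have h' := Nat.doubleFactorial_two_mul (m + 1)
    rw [show 2 * (m + 1) - 1 = 2 * m + 1 by omega, mul_comm (m + 1).factorial, ← h']
    exact h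



/-- Fix a vertex `u` and integers `k, t, ℓ` with `t ≤ log n/(2k)`.
The number of `2t`-tuples of walks of length `k` starting at `u` in the complete graph
on `n` vertices such that every traversed edge occurs at least twice in the multiset of
traversed edges, and exactly `ℓ` distinct edges are traversed, is at most
`C(2tk, 2ℓ)·(2ℓ-1)!!·ℓ^{2kt-2ℓ}·n^ℓ`. -/
theorem walk_counting (n k t ℓ : ℕ) (u : Fin n) (hk : 0 < k)
    (ht : (t : ℝ) ≤ Real.log n / (2 * k)) :
    {W : Fin (2 * t) → Fin (k + 1) → Fin n |
        (∀ i, W i 0 = u) ∧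
        (∀ e ∈ walkEdges W, 2 ≤ (walkEdges W).count e) ∧
        (walkEdges W).toFinset.card = ℓ}.ncard ≤
      Nat.choose (2 * t * k) (2 * ℓ) * Nat.doubleFactorial (2 * ℓ - 1) *
        ℓ ^ (2 * k * t - 2 * ℓ) * n ^ ℓ := by
  classical
  set A := {W : Fin (2 * t) → Fin (k + 1) → Fin n |
        (∀ i, W i 0 = u) ∧
        (∀ e ∈ walkEdges W, 2 ≤ (walkEdges W).count e) ∧
        (walkEdges W).toFinset.card = ℓ}
  let r : (Fin (2 * t) → Fin (k + 1) → Fin n) →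
      (Fin ℓ × Bool ↪ Fin (2 * t) × Fin k) × (Fin (2 * t) × Fin k → Fin ℓ) → Prop :=
    fun W x => ∀ p q, x.2 p = x.2 q → s(W p.1 p.2.castSucc, W p.1 p.2.succ) =
      s(W q.1 q.2.castSucc, W q.1 q.2.succ)
  have hdc := Finset.card_mul_le_card_mul r (s := A.toFinset)
    (t := Finset.univ.filter fun x => ∀ y, x.2 (x.1 y) = y.1)
    (m := ℓ.factorial * 2 ^ ℓ) (n := n ^ ℓ)
    (fun W hW => by
      obtain ⟨-, h₂, hℓ⟩ := Set.mem_toFinset.1 hW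
      obtain ⟨c, hc, hcW⟩ := exists_edge_labelling W h₂ hℓ
      refine (factorial_mul_two_pow_le_card_marked_labellings c hc).trans
        (Finset.card_le_card fun x hx => ?_)
      simp only [Finset.mem_filter, Finset.mem_univ, true_and] at hx
      simp only [Finset.bipartiteAbove, Finset.mem_filter, Finset.mem_univ, true_and]
      exact ⟨hx.1, fun p q h => hcW p q (hx.2 p q h)⟩)
    (fun x hx => by
      simp only [Finset.mem_filter, Finset.mem_univ, true_and] at hx
      refine card_walks_compatible_le u x.2 (fun i => ⟨_, hx (i, true)⟩) _ ?_ ?_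
      · intro W hW
        exact (Set.mem_toFinset.1 (Finset.mem_filter.1 hW).1).1
      · intro W hW
        exact (Finset.mem_filter.1 hW).2)
  have hT := card_marked_labellings_le (P := Fin (2 * t) × Fin k) ℓ
  rw [Fintype.card_prod, Fintype.card_fin, Fintype.card_fin,
    Nat.descFactorial_eq_factorial_mul_choose,
    factorial_two_mul_eq] at hT
  rw [Set.ncard_eq_toFinset_card']
  have hpos : 0 < ℓ.factorial * 2 ^ ℓ := by positivity
  refine Nat.le_of_mul_le_mul_right ((hdc.trans (Nat.mul_le_mul_right _ hT)).trans_eq ?_) hpos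
  rw [show 2 * k * t = 2 * t * k by ring]
  ring
end
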